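/- Let m, n be positive integers. For any m×n real matrix Θ = (θ_{i,j}), the set 𝓑(Θ) of vectors (η_1, …, η_n) ∈ ℝ^n for which inf over x ∈ ℤ^m \ {0} of (max_{1≤j≤n} ‖L_j(x) − η_j‖)^n · (max_{1≤i≤m} |x_i|)^m > 0 is dense in ℝ^n. -/

import Mathlib

/-- Distance from a real number to the nearest integer. -/
noncomputable def dnint (t : ℝ) : ℝ := ⨅ k : ℤ, |t - (k : ℝ)|

lemma dnint_bdd (t : ℝ) : BddBelow (Set.range fun k : ℤ => |t - (k : ℝ)|) :=
  ⟨0, by rintro _ ⟨k, rfl⟩; exact abs_nonneg _⟩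

lemma dnint_le (t : ℝ) (k : ℤ) : dnint t ≤ |t - k| := ciInf_le (dnint_bdd t) k

lemma dnint_eq (t : ℝ) : ∃ k : ℤ, dnint t = |t - k| :=
  ⟨round t, le_antisymm (dnint_le t _) (le_ciInf fun k => round_le t k)⟩

lemma dnint_nonneg (t : ℝ) : 0 ≤ dnint t := by
  obtain ⟨k, hk⟩ := dnint_eq t
  rw [hk]; exact abs_nonneg _

lemma dnint_sub_le (s t : ℝ) : dnint s ≤ dnint t + |s - t| := by
  obtain ⟨k, hk⟩ := dnint_eq t
  have h := dnint_le s k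
  have : |s - k| ≤ |s - t| + |t - k| := abs_sub_le _ _ _
  linarith

/-- If a shift by `μ ≤ 1/2`, then one of the two points is far from the integers. -/
lemma dnint_shift (v μ : ℝ) (hμ : |μ| ≤ 1 / 2) :
    |μ| / 2 ≤ dnint v ∨ |μ| / 2 ≤ dnint (v + μ) := by
  by_contra! h
  obtain ⟨h1, h2⟩ := h
  obtain ⟨k, hk⟩ := dnint_eq v
  obtain ⟨l, hl⟩ := dnint_eq (v + μ)
  rw [hk] at h1
  rw [hl] at h2
  have h3 : |μ - ((l - k : ℤ) : ℝ)| < |μ| := by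
    have : μ - ((l - k : ℤ) : ℝ) = (v + μ - l) - (v - k) := by push_cast; ring
    rw [this]
    have := abs_sub (v + μ - l) (v - k)
    linarith
  have h4 : |((l - k : ℤ) : ℝ)| < 1 := by
    have : ((l - k : ℤ) : ℝ) = μ - (μ - ((l - k : ℤ) : ℝ)) := by ring
    rw [this]
    have := abs_sub μ (μ - ((l - k : ℤ) : ℝ))
    linarith
  have h5 : l - k = 0 := by
    rw [← Int.cast_abs] at h4
    have : |l - k| < 1 := by exact_mod_cast h4
    exact Int.abs_lt_one_iff.mp this
  rw [h5] at h3
  simp at h3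

lemma dirichlet (m n : ℕ) (hn : 0 < n) (θ : Fin m → Fin n → ℝ) (Q N : ℕ)
    (hN : 0 < N) (h : N ^ m < (Q + 1) ^ n) :
    ∃ y : Fin n → ℤ, y ≠ 0 ∧ ‖y‖ ≤ Q ∧
      ∀ i, dnint (∑ j, θ i j * (y j : ℝ)) ≤ 1 / N := by
  have hN' : (0 : ℝ) < N := by exact_mod_cast hN
  let M : (Fin n → Fin (Q + 1)) → Fin m → ℝ := fun y i => ∑ j, θ i j * ((y j : ℕ) : ℝ)
  have hlt : ∀ t : ℝ, ⌊(N : ℝ) * Int.fract t⌋₊ < N := by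
    intro t
    rw [Nat.floor_lt (mul_nonneg hN'.le (Int.fract_nonneg t))]
    have := Int.fract_lt_one t
    nlinarith
  let F : (Fin n → Fin (Q + 1)) → (Fin m → Fin N) := fun y i =>
    ⟨⌊(N : ℝ) * Int.fract (M y i)⌋₊, hlt _⟩
  obtain ⟨y, y', hne, hF⟩ := Fintype.exists_ne_map_eq_of_card_lt F (by simpa using h)
  refine ⟨fun j => (y j : ℤ) - (y' j : ℤ), ?_, ?_, ?_⟩
  · intro h0
    apply hne
    funext j
    have := congrFun h0 j
    simp only [Pi.zero_apply] at this
    apply Fin.ext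
    omega
  · rw [pi_norm_le_iff_of_nonneg (by positivity)]
    intro j
    rw [Int.norm_eq_abs]
    have h1 := (y j).isLt
    have h2 := (y' j).isLt
    have : |(y j : ℤ) - (y' j : ℤ)| ≤ Q := by rw [abs_le]; constructor <;> omega
    exact_mod_cast this
  · intro i
    have hi := congrArg Fin.val (congrFun hF i)
    simp only [F] at hi
    have hs : (∑ j, θ i j * (((y j : ℤ) - (y' j : ℤ) : ℤ) : ℝ)) = M y i - M y' i := by
      simp only [M]
      rw [← Finset.sum_sub_distrib]
      refine Finset.sum_congr rfl fun j _ => ?_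
      push_cast
      ring
    rw [hs]
    refine (dnint_le _ (⌊M y i⌋ - ⌊M y' i⌋)).trans ?_
    have e : M y i - M y' i - ((⌊M y i⌋ - ⌊M y' i⌋ : ℤ) : ℝ)
        = Int.fract (M y i) - Int.fract (M y' i) := by
      push_cast
      simp only [Int.fract]
      ring
    rw [e]
    have a1 := Nat.floor_le (mul_nonneg hN'.le (Int.fract_nonneg (M y i)))
    have a2 := Nat.lt_floor_add_one ((N : ℝ) * Int.fract (M y i))
    have b1 := Nat.floor_le (mul_nonneg hN'.le (Int.fract_nonneg (M y' i)))
    have b2 := Nat.lt_floor_add_one ((N : ℝ) * Int.fract (M y' i))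
    rw [hi] at a1 a2
    rw [le_div_iff₀ hN']
    have : |Int.fract (M y i) - Int.fract (M y' i)| * N
        = |(N : ℝ) * Int.fract (M y i) - N * Int.fract (M y' i)| := by
      rw [← mul_sub, abs_mul, abs_of_pos hN', mul_comm]
    rw [this, abs_le]
    constructor <;> linarith

/-- Simultaneous minimizers with the Dirichlet bound. -/
lemma exists_min (m n : ℕ) (hn : 0 < n) (θ : Fin m → Fin n → ℝ) (b : ℕ) (hb : 0 < b) (s : ℕ) :
    ∃ w : Fin n → ℤ, w ≠ 0 ∧ ‖w‖ ≤ ((b : ℝ) ^ m) ^ s ∧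
      ‖fun i => dnint (∑ j, θ i j * (w j : ℝ))‖ ≤ 1 / ((b : ℝ) ^ s) ^ n ∧
      ∀ y : Fin n → ℤ, y ≠ 0 → ‖y‖ ≤ ((b : ℝ) ^ m) ^ s →
        ‖fun i => dnint (∑ j, θ i j * (w j : ℝ))‖ ≤
          ‖fun i => dnint (∑ j, θ i j * (y j : ℝ))‖ := by
  obtain ⟨y, y0, yQ, yN⟩ := dirichlet m n hn θ ((b ^ m) ^ s) ((b ^ s) ^ n) (by positivity) (by
    have : ((b ^ s) ^ n) ^ m = ((b ^ m) ^ s) ^ n := by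
      simp only [← pow_mul]; congr 1; ring
    rw [this]
    exact Nat.pow_lt_pow_left (Nat.lt_succ_self _) hn.ne')
  push_cast at yQ yN
  let S : Set (Fin n → ℤ) := {y | y ≠ 0 ∧ ‖y‖ ≤ ((b : ℝ) ^ m) ^ s}
  have hS : S.Finite := by
    apply (Metric.finite_isBounded_inter_isClosed (K := Metric.closedBall (0 : Fin n → ℤ) (((b : ℝ) ^ m) ^ s)) (s := Set.univ) ?_ Metric.isBounded_closedBall isClosed_univ).subset
    · rintro y ⟨_, hy⟩
      simpa using hy
    · exact isDiscrete_univ_iff.mpr inferInstance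
  obtain ⟨w, hw, hmin⟩ := Set.exists_min_image S
    (fun y => ‖fun i => dnint (∑ j, θ i j * (y j : ℝ))‖) hS ⟨y, y0, yQ⟩
  refine ⟨w, hw.1, hw.2, (hmin y ⟨y0, yQ⟩).trans ?_, fun y h1 h2 => hmin y ⟨h1, h2⟩⟩
  rw [pi_norm_le_iff_of_nonneg (by positivity)]
  intro i
  rw [Real.norm_of_nonneg (dnint_nonneg _)]
  exact yN i

lemma exists_coord {n : ℕ} (hn : 0 < n) (w : Fin n → ℤ) : ∃ j, |(w j : ℝ)| = ‖w‖ := by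
  haveI : Nonempty (Fin n) := ⟨⟨0, hn⟩⟩
  obtain ⟨j, hj⟩ := Finite.exists_max (fun j => ‖w j‖)
  refine ⟨j, ?_⟩
  rw [← Int.norm_eq_abs]
  exact le_antisymm (norm_le_pi_norm w j) ((pi_norm_le_iff_of_nonneg (norm_nonneg _)).mpr hj)

/-- One step of the game. -/
lemma game_step {n : ℕ} (hn : 0 < n) (w : Fin n → ℤ) (ρ : ℝ) (hρ : 0 < ρ)
    (h : ‖w‖ * ρ ≤ 1) (e : Fin n → ℝ) :
    ∃ e' : Fin n → ℝ, dist e e' ≤ ρ / 2 ∧ ‖w‖ * ρ / 4 ≤ dnint (∑ j, w j * e' j) := by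
  obtain ⟨j, hj⟩ := exists_coord hn w
  have hμ : |(w j : ℝ) * (ρ / 2)| = ‖w‖ * ρ / 2 := by
    rw [abs_mul, hj, abs_of_pos (by positivity)]; ring
  rcases dnint_shift (∑ j, w j * e j) ((w j : ℝ) * (ρ / 2)) (by rw [hμ]; linarith) with h1 | h1
  · refine ⟨e, by rw [dist_self]; positivity, ?_⟩
    rw [hμ] at h1; linarith
  · refine ⟨e + Pi.single j (ρ / 2), ?_, ?_⟩
    · rw [dist_eq_norm, sub_add_cancel_left, norm_neg, Pi.norm_single, Real.norm_of_nonneg (by positivity)]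
    · have : ∑ i, (w i : ℝ) * (e + Pi.single j (ρ / 2) : Fin n → ℝ) i
          = (∑ j, w j * e j) + (w j : ℝ) * (ρ / 2) := by
        simp [mul_add, Finset.sum_add_distrib, Pi.single_apply]
      rw [this]
      rw [hμ] at h1; linarith

lemma game {n : ℕ} (hn : 0 < n) (w : ℕ → Fin n → ℤ) (R : ℝ) (hR : 8 * n ≤ R)
    (hw : ∀ s, ‖w s‖ ≤ R ^ s) (a : ℝ) (ha : 0 < a) (ha1 : a ≤ 1) (e0 : Fin n → ℝ) :
    ∃ η : Fin n → ℝ, dist e0 η ≤ a ∧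
      ∀ s, R ^ s ≤ R * ‖w s‖ → a / (8 * R) ≤ dnint (∑ j, w s j * η j) := by
  have hn1 : (1 : ℝ) ≤ n := by exact_mod_cast hn
  have hR0 : 0 < R := by linarith
  have hr : R⁻¹ ≤ 1 / 8 := by
    rw [inv_le_comm₀ hR0 (by norm_num)]; norm_num; linarith
  have hr0 : 0 < R⁻¹ := by positivity
  have step : ∀ s e, ∃ e' : Fin n → ℝ, dist e e' ≤ a / 2 * R⁻¹ ^ s ∧
      ‖w s‖ * (a * R⁻¹ ^ s) / 4 ≤ dnint (∑ j, w s j * e' j) := by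
    intro s e
    have := game_step hn (w s) (a * R⁻¹ ^ s) (by positivity) (by
      calc ‖w s‖ * (a * R⁻¹ ^ s) ≤ R ^ s * (1 * R⁻¹ ^ s) := by gcongr; exact hw s
        _ = 1 := by rw [inv_pow, one_mul]; exact mul_inv_cancel₀ (by positivity)) e
    obtain ⟨e', h1, h2⟩ := this
    exact ⟨e', by linarith, h2⟩
  choose f hf1 hf2 using step
  let e : ℕ → Fin n → ℝ := fun s => Nat.rec e0 (fun s x => f s x) s
  have he : ∀ s, e (s + 1) = f s (e s) := fun s => rfl
  have hd : ∀ s, dist (e s) (e (s + 1)) ≤ a / 2 * R⁻¹ ^ s := fun s => hf1 s (e s)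
  have hr1 : R⁻¹ < 1 := by linarith
  obtain ⟨η, hη⟩ := cauchySeq_tendsto_of_complete (cauchySeq_of_le_geometric _ _ hr1 hd)
  have hball : ∀ s, dist (e s) η ≤ a * R⁻¹ ^ s := by
    intro s
    refine (dist_le_of_le_geometric_of_tendsto _ _ hr1 hd hη s).trans ?_
    rw [div_le_iff₀ (by linarith)]
    have : 0 < a * R⁻¹ ^ s := by positivity
    nlinarith
  refine ⟨η, by simpa [e] using hball 0, ?_⟩
  intro s hs
  have h1 := hf2 s (e s)
  rw [← he] at h1
  have h2 := dnint_sub_le (∑ j, w s j * e (s + 1) j) (∑ j, w s j * η j)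
  have h3 : |(∑ j, w s j * e (s + 1) j) - (∑ j, w s j * η j)|
      ≤ n * (‖w s‖ * (a * R⁻¹ ^ (s + 1))) := by
    rw [← Finset.sum_sub_distrib]
    refine (Finset.abs_sum_le_sum_abs _ _).trans ?_
    refine (Finset.sum_le_card_nsmul _ _ (‖w s‖ * (a * R⁻¹ ^ (s + 1))) ?_).trans (by simp)
    intro j _
    rw [← mul_sub, abs_mul]
    gcongr
    · rw [← Int.norm_eq_abs]; exact norm_le_pi_norm _ j
    · rw [← Real.dist_eq]; exact (dist_le_pi_dist _ _ j).trans (hball (s + 1))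
  have h4 : n * (‖w s‖ * (a * R⁻¹ ^ (s + 1))) ≤ ‖w s‖ * (a * R⁻¹ ^ s) / 8 := by
    have : n * (‖w s‖ * (a * R⁻¹ ^ (s + 1))) = (‖w s‖ * (a * R⁻¹ ^ s)) * (n * R⁻¹) := by ring
    rw [this]
    have : n * R⁻¹ ≤ 1 / 8 := by
      rw [← div_eq_mul_inv, div_le_iff₀ hR0]; linarith
    have h0 : 0 ≤ ‖w s‖ * (a * R⁻¹ ^ s) := by positivity
    nlinarith
  have h5 : a / (8 * R) ≤ ‖w s‖ * (a * R⁻¹ ^ s) / 8 := by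
    have : ‖w s‖ * (a * R⁻¹ ^ s) / 8 = a * (R * ‖w s‖) / (8 * R * R ^ s) := by
      rw [inv_pow]
      field_simp
    rw [this, div_le_div_iff₀ (by positivity) (by positivity)]
    have : a * (8 * R) * R ^ s ≤ a * (8 * R) * (R * ‖w s‖) := by gcongr
    nlinarith
  linarith

lemma transfer {m n : ℕ} (θ : Fin m → Fin n → ℝ) (x : Fin m → ℤ) (z : Fin n → ℤ)
    (η : Fin n → ℝ) (D X ζ : ℝ) 
    (hD : ∀ j, dnint ((∑ i, θ i j * (x i : ℝ)) - η j) ≤ D)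
    (hX : ∀ i, |(x i : ℝ)| ≤ X)
    (hζ : ∀ i, dnint (∑ j, θ i j * (z j : ℝ)) ≤ ζ) :
    dnint (∑ j, z j * η j) ≤ n * (‖z‖ * D) + m * (X * ζ) := by
  choose k hk using fun j => dnint_eq ((∑ i, θ i j * (x i : ℝ)) - η j)
  choose l hl using fun i => dnint_eq (∑ j, θ i j * (z j : ℝ))
  refine (dnint_le _ (∑ i, x i * l i - ∑ j, z j * k j)).trans ?_
  have key : (∑ j, z j * η j) - ((∑ i, x i * l i - ∑ j, z j * k j : ℤ) : ℝ)
      = (∑ i, (x i : ℝ) * ((∑ j, θ i j * (z j : ℝ)) - l i))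
        - ∑ j, (z j : ℝ) * ((∑ i, θ i j * (x i : ℝ)) - η j - k j) := by
    push_cast
    simp only [mul_sub, Finset.sum_sub_distrib, Finset.mul_sum]
    rw [Finset.sum_comm (f := fun (i : Fin m) (j : Fin n) => (x i : ℝ) * (θ i j * z j))]
    have : ∀ j i, (x i : ℝ) * (θ i j * z j) = z j * (θ i j * x i) := fun j i => by ring
    simp only [this]
    ring
  rw [key]
  have A : |∑ i, (x i : ℝ) * ((∑ j, θ i j * (z j : ℝ)) - l i)| ≤ m * (X * ζ) := by
    refine (Finset.abs_sum_le_sum_abs _ _).trans ?_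
    refine (Finset.sum_le_card_nsmul _ _ (X * ζ) ?_).trans (by simp)
    intro i _
    rw [abs_mul]
    have hX0 := (abs_nonneg _).trans (hX i)
    exact mul_le_mul (hX i) ((hl i).symm.le.trans (hζ i)) (abs_nonneg _) hX0
  have B : |∑ j, (z j : ℝ) * ((∑ i, θ i j * (x i : ℝ)) - η j - k j)| ≤ n * (‖z‖ * D) := by
    refine (Finset.abs_sum_le_sum_abs _ _).trans ?_
    refine (Finset.sum_le_card_nsmul _ _ (‖z‖ * D) ?_).trans (by simp)
    intro j _
    rw [abs_mul]
    refine mul_le_mul ?_ ((hk j).symm.le.trans (hD j)) (abs_nonneg _) (norm_nonneg _)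
    rw [← Int.norm_eq_abs]; exact norm_le_pi_norm _ j
  have := abs_sub (∑ i, (x i : ℝ) * ((∑ j, θ i j * (z j : ℝ)) - l i))
    (∑ j, (z j : ℝ) * ((∑ i, θ i j * (x i : ℝ)) - η j - k j))
  linarith

/-- For any `Θ`, the set of `η ∈ ℝ^n` badly approximable with respect to the
inhomogeneous forms `L_j(x) - η_j` is dense in `ℝ^n`. -/
theorem bad_set_dense (m n : ℕ) (hm : 0 < m) (hn : 0 < n)
    (θ : Fin m → Fin n → ℝ) :
    Dense {η : Fin n → ℝ |
        0 < ⨅ x : {x : Fin m → ℤ // x ≠ 0},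
            (⨆ j : Fin n, dnint ((∑ i : Fin m, θ i j * (x.val i : ℝ)) - η j)) ^ n *
              (⨆ i : Fin m, (|x.val i| : ℝ)) ^ m} := by
  rw [Metric.dense_iff]
  intro e0 ε hε
  set b : ℕ := 8 * n with hbdef
  have hb : 0 < b := by omega
  have hn1 : (1 : ℝ) ≤ n := by exact_mod_cast hn
  have hm1 : (1 : ℝ) ≤ m := by exact_mod_cast hm
  have hbR : (b : ℝ) = 8 * n := by rw [hbdef]; push_cast; ring
  have hb1 : (1 : ℝ) < b := by rw [hbR]; linarith
  have hb0 : (0 : ℝ) < b := by linarith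
  choose w w0 wR wD wmin using exists_min m n hn θ b hb
  set R : ℝ := (b : ℝ) ^ m with hRdef
  have hR : 8 * (n : ℝ) ≤ R := by
    rw [← hbR]; exact le_self_pow₀ hb1.le hm.ne'
  have hR1 : 1 ≤ R := by linarith
  have hR0 : 0 < R := by linarith
  set a := min 1 (ε / 2) with hadef
  have ha : 0 < a := by positivity
  have ha1 : a ≤ 1 := min_le_left _ _
  obtain ⟨η, hη, hgame⟩ := game hn w R hR wR a ha ha1 e0
  set c := a / (8 * R) with hc
  have hc0 : 0 < c := by positivity
  have hc1 : c ≤ 1 := by rw [hc, div_le_one (by positivity)]; linarith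
  have norm1 : ∀ {k : ℕ} (y : Fin k → ℤ), y ≠ 0 → 1 ≤ ‖y‖ := by
    intro k y hy
    obtain ⟨j, hj⟩ := Function.ne_iff.mp hy
    refine le_trans ?_ (norm_le_pi_norm y j)
    rw [Int.norm_eq_abs]
    exact_mod_cast Int.one_le_abs hj
  have hz : ∀ s, ∃ z : Fin n → ℤ, z ≠ 0 ∧ ‖z‖ ≤ R ^ s ∧
      ‖fun i => dnint (∑ j, θ i j * (z j : ℝ))‖ ≤ ‖fun i => dnint (∑ j, θ i j * (w s j : ℝ))‖ ∧
      c ≤ dnint (∑ j, z j * η j) := by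
    intro s
    induction s with
    | zero =>
      refine ⟨w 0, w0 0, wR 0, le_rfl, hgame 0 ?_⟩
      have := norm1 (w 0) (w0 0)
      rw [pow_zero]; nlinarith
    | succ s ih =>
      obtain ⟨z, z0, zR, zmin, zc⟩ := ih
      rcases le_total ‖w (s + 1)‖ (R ^ s) with h | h
      · refine ⟨z, z0, zR.trans (pow_le_pow_right₀ hR1 (Nat.le_succ s)), ?_, zc⟩
        exact zmin.trans (wmin s _ (w0 _) h)
      · refine ⟨w (s + 1), w0 _, wR _, le_rfl, hgame _ ?_⟩
        rw [pow_succ, mul_comm]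
        gcongr
  refine ⟨η, ?_, ?_⟩
  · rw [Metric.mem_ball, dist_comm]
    have : a ≤ ε / 2 := min_le_right _ _
    linarith
  set K : ℝ := 2 * m / c with hK
  have hK0 : 0 < K := by positivity
  have hK1 : 1 ≤ K := by rw [hK, one_le_div hc0]; linarith
  have hpos : 0 < (c / (2 * n)) ^ n / ((b : ℝ) ^ n * K) ^ m := by positivity
  haveI : Nonempty {x : Fin m → ℤ // x ≠ 0} :=
    ⟨⟨fun _ => 1, fun h => by simpa using congrFun h ⟨0, hm⟩⟩⟩
  refine lt_of_lt_of_le hpos (le_ciInf ?_)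
  rintro ⟨x, hx⟩
  simp only
  set D := ⨆ j : Fin n, dnint ((∑ i : Fin m, θ i j * (x i : ℝ)) - η j) with hDdef
  set X := ⨆ i : Fin m, |(x i : ℝ)| with hXdef
  have hD : ∀ j, dnint ((∑ i, θ i j * (x i : ℝ)) - η j) ≤ D :=
    fun j => le_ciSup (f := fun j => dnint ((∑ i : Fin m, θ i j * (x i : ℝ)) - η j))
      (Set.finite_range _).bddAbove j
  have hX : ∀ i, |(x i : ℝ)| ≤ X :=
    fun i => le_ciSup (f := fun i => |(x i : ℝ)|) (Set.finite_range _).bddAbove i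
  have hX1 : 1 ≤ X := by
    obtain ⟨j, hj⟩ := exists_coord hm x
    exact (norm1 x hx).trans (hj.symm.le.trans (hX j))
  have hKX : 1 ≤ K * X := by nlinarith
  have hbn : (1 : ℝ) < (b : ℝ) ^ n := one_lt_pow₀ hb1 hn.ne'
  have hex : ∃ s : ℕ, K * X ≤ ((b : ℝ) ^ n) ^ s := 
    (pow_unbounded_of_one_lt (K * X) hbn).imp fun _ h => h.le
  obtain ⟨s, hs1, hs2⟩ : ∃ s : ℕ, K * X ≤ ((b : ℝ) ^ n) ^ s ∧
      ((b : ℝ) ^ n) ^ s ≤ (b : ℝ) ^ n * (K * X) := by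
    classical
    refine ⟨Nat.find hex, Nat.find_spec hex, ?_⟩
    rcases h : Nat.find hex with _ | t
    · rw [pow_zero]; nlinarith
    · have := Nat.find_min hex (m := t) (by omega)
      push Not at this
      rw [pow_succ, mul_comm]
      gcongr
  obtain ⟨z, z0, zR, zmin, zc⟩ := hz s
  have hζ : ∀ i, dnint (∑ j, θ i j * (z j : ℝ)) ≤ 1 / ((b : ℝ) ^ s) ^ n := by
    intro i
    refine le_trans ?_ (zmin.trans (wD s))
    refine le_trans (le_abs_self _) ?_
    exact norm_le_pi_norm (fun i => dnint (∑ j, θ i j * (z j : ℝ))) i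
  have ht := transfer θ x z η D X _ hD hX hζ
  have hcomm : ((b : ℝ) ^ s) ^ n = ((b : ℝ) ^ n) ^ s := by rw [← pow_mul, ← pow_mul, mul_comm]
  rw [hcomm] at ht
  have hsmall : m * (X * (1 / ((b : ℝ) ^ n) ^ s)) ≤ c / 2 := by
    have h1 : m * (X * (1 / ((b : ℝ) ^ n) ^ s)) = m * X / ((b : ℝ) ^ n) ^ s := by ring
    rw [h1, div_le_iff₀ (by positivity)]
    have h2 : c * (K * X) = 2 * m * X := by rw [hK]; field_simp
    have h3 : c * (K * X) ≤ c * ((b : ℝ) ^ n) ^ s := by gcongr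
    linarith
  have hD0 : 0 ≤ D := (dnint_nonneg _).trans (hD ⟨0, hn⟩)
  have hDlow : c / (2 * n) / R ^ s ≤ D := by
    have h1 : (n : ℝ) * (‖z‖ * D) ≤ n * (R ^ s * D) := by gcongr
    rw [div_div, div_le_iff₀ (by positivity)]
    nlinarith
  have hX0 : 0 < X := by linarith
  have hRs : (R ^ s) ^ n ≤ ((b : ℝ) ^ n * K) ^ m * X ^ m := by
    have : (R ^ s) ^ n = (((b : ℝ) ^ n) ^ s) ^ m := by
      rw [hRdef]; simp only [← pow_mul]; congr 1; ring
    rw [this, ← mul_pow, mul_assoc]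
    gcongr
  calc (c / (2 * n)) ^ n / ((b : ℝ) ^ n * K) ^ m
      = (c / (2 * n)) ^ n / (((b : ℝ) ^ n * K) ^ m * X ^ m) * X ^ m := by field_simp
    _ ≤ (c / (2 * n)) ^ n / (R ^ s) ^ n * X ^ m := by gcongr
    _ = (c / (2 * n) / R ^ s) ^ n * X ^ m := by rw [div_pow _ (R ^ s)]
    _ ≤ D ^ n * X ^ m := by gcongr
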